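/- arXiv:2503.09442 — 4 statements merged into one kernel-verified Lean document; each statement's English description precedes it below -/
import Mathlib

section
/- Let r ≥ 2 be an integer and ε > 0. There exists a constant C = C(r, ε) > 0 such that for every b ∈ ℝ^r, every real N ≥ 1, and every A ∈ ℝ, the number of lattice points ξ ∈ J_{b,N} with |ξ|² = A is at most C · N^{r − 2 + ε}. -/
open scoped Classical

noncomputable section

/-- The lattice box `J_{b,N} = {ξ ∈ ℤ^r : b i ≤ ξ i ≤ b i + N for all i}`. -/
def latticeBox (r : ℕ) (b : Fin r → ℝ) (N : ℝ) : Finset (Fin r → ℤ) :=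
  Fintype.piFinset fun i => Finset.Icc ⌈b i⌉ ⌊b i + N⌋

/-- The squared Euclidean norm `|ξ|²` of a lattice point. -/
def eNormSq {r : ℕ} (ξ : Fin r → ℤ) : ℝ := ∑ i, ((ξ i : ℝ)) ^ 2

/-- For every prime `p` not dividing `m`, the Gaussian integers of norm `p ^ k * m` are products of
one of `k + 1` fixed elements with an element of norm `m`. -/
lemma GaussianInt.exists_factor_of_norm_eq_prime_pow_mul {p : ℕ} (hp : p.Prime) {m : ℕ}
    (hm : ¬ p ∣ m) (k : ℕ) :
    ∃ c : ℕ → GaussianInt, ∀ z : GaussianInt, z.norm = (p ^ k * m : ℕ) →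
      ∃ j ∈ Finset.range (k + 1), ∃ w : GaussianInt, z = c j * w ∧ w.norm = m := by
  have := Fact.mk hp
  have hp0 : (p : ℤ) ≠ 0 := by exact_mod_cast hp.ne_zero
  by_cases hirr : Irreducible (p : GaussianInt)
  · have hpr := hirr.prime
    refine ⟨fun _ => (p : GaussianInt) ^ (k / 2), fun z hz => ⟨0, by simp, ?_⟩⟩
    have key : ∀ z : GaussianInt, (p : ℤ) ∣ z.norm → ∃ w : GaussianInt, z = p * w := by
      intro z h
      have h1 : (p : GaussianInt) ∣ z * star z := by
        rw [← Zsqrtd.norm_eq_mul_conj]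
        obtain ⟨t, ht⟩ := h
        exact ⟨t, by rw [ht]; push_cast; ring⟩
      rcases hpr.dvd_or_dvd h1 with ⟨w, hw⟩ | ⟨w, hw⟩
      · exact ⟨w, hw⟩
      · refine ⟨star w, ?_⟩
        rw [← star_star z, hw, star_mul, mul_comm]
        congr 1
    induction k using Nat.twoStepInduction generalizing z with
    | zero => exact ⟨z, by simp, by simpa using hz⟩
    | one =>
      exfalso
      obtain ⟨w, rfl⟩ := key z (by rw [hz]; push_cast; exact ⟨m, by ring⟩)
      rw [Zsqrtd.norm_mul, Zsqrtd.norm_natCast] at hz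
      push_cast at hz
      have : (m : ℤ) = p * w.norm := mul_left_cancel₀ hp0 (by linarith)
      exact hm (by exact_mod_cast (Dvd.intro _ this.symm : (p : ℤ) ∣ m))
    | more k ih _ =>
      obtain ⟨w, rfl⟩ := key z (by rw [hz]; push_cast; exact ⟨p ^ (k + 1) * m, by ring⟩)
      rw [Zsqrtd.norm_mul, Zsqrtd.norm_natCast] at hz
      push_cast at hz
      obtain ⟨v, hv, hv'⟩ := ih w (by
        push_cast
        exact mul_left_cancel₀ (mul_ne_zero hp0 hp0) (by rw [hz]; ring))
      refine ⟨v, ?_, hv'⟩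
      simp only at hv ⊢
      rw [hv, show (k + 2) / 2 = k / 2 + 1 by omega]
      ring
  · obtain ⟨a, b, hab⟩ := GaussianInt.sq_add_sq_of_nat_prime_of_not_irreducible p hirr
    set q : GaussianInt := ⟨a, b⟩ with hq
    have hqn : q.norm = p := by
      rw [← hab, Zsqrtd.norm_def]; push_cast; simp [hq]; ring
    have hqs : (p : GaussianInt) = q * star q := by
      rw [← Zsqrtd.norm_eq_mul_conj, hqn]; simp
    have hqi : Irreducible q := by
      have hu : ∀ x : GaussianInt, IsUnit x ↔ x.norm.natAbs = 1 :=
        fun x => Zsqrtd.norm_eq_one_iff.symm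
      refine ⟨fun h => ?_, fun x y hxy => ?_⟩
      · rw [hu, hqn] at h
        exact hp.one_lt.ne' (by simpa using h)
      · rw [hu, hu]
        have : x.norm.natAbs * y.norm.natAbs = p := by
          rw [← Int.natAbs_mul, ← Zsqrtd.norm_mul, ← hxy, hqn]; simp
        rcases (Nat.dvd_prime hp).1 (Dvd.intro _ this) with h | h
        · exact Or.inl h
        · right
          rw [h] at this
          exact Nat.eq_of_mul_eq_mul_left hp.pos (by omega)
    have key : ∀ (k : ℕ) (z : GaussianInt), z.norm = (p ^ k * m : ℕ) →
        ∃ i ≤ k, ∃ w : GaussianInt, z = q ^ i * star q ^ (k - i) * w ∧ w.norm = m := by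
      intro k
      induction k with
      | zero => exact fun z hz => ⟨0, le_rfl, z, by simp, by simpa using hz⟩
      | succ k ih =>
        intro z hz
        have step : ∀ w : GaussianInt, (p : ℤ) * w.norm = z.norm → w.norm = (p ^ k * m : ℕ) := by
          intro w hw
          refine mul_left_cancel₀ hp0 ?_
          rw [hw, hz]; push_cast; ring
        have h1 : q ∣ z * star z := by
          rw [← Zsqrtd.norm_eq_mul_conj, hz]
          refine ⟨star q * (p ^ k * m : ℕ), ?_⟩
          rw [← mul_assoc, ← hqs]; push_cast; ring
        rcases hqi.prime.dvd_or_dvd h1 with ⟨w, hw⟩ | ⟨w, hw⟩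
        · obtain ⟨i, hi, v, hv, hv'⟩ := ih w (step w (by rw [hw, Zsqrtd.norm_mul, hqn]))
          refine ⟨i + 1, by omega, v, ?_, hv'⟩
          rw [hw, hv, show k + 1 - (i + 1) = k - i by omega]
          ring
        · have hz' : z = star q * star w := by
            rw [← star_star z, hw, star_mul, mul_comm]
          obtain ⟨i, hi, v, hv, hv'⟩ := ih (star w) (step _ (by
            rw [hz', Zsqrtd.norm_mul, Zsqrtd.norm_conj q, hqn]))
          refine ⟨i, by omega, v, ?_, hv'⟩
          rw [hz', hv, show k + 1 - i = k - i + 1 by omega]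
          ring
    refine ⟨fun i => q ^ i * star q ^ (k - i), fun z hz => ?_⟩
    obtain ⟨i, hi, h⟩ := key k z hz
    exact ⟨i, by simpa using Nat.lt_succ_of_le hi, h⟩

/-- There are at most `4 d(n)` Gaussian integers of norm `n ≥ 1`. -/
lemma GaussianInt.card_norm_eq_le {n : ℕ} (hn : n ≠ 0) (S : Finset GaussianInt)
    (hS : ∀ z ∈ S, z.norm = n) : S.card ≤ 4 * n.divisors.card := by
  induction n using Nat.recOnPrimePow generalizing S with
  | zero => exact absurd rfl hn
  | one =>
    have hsub : S ⊆ {⟨1, 0⟩, ⟨-1, 0⟩, ⟨0, 1⟩, ⟨0, -1⟩} := by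
      rintro ⟨x, y⟩ hz
      have h := hS _ hz
      rw [Zsqrtd.norm_def] at h
      simp only [Nat.cast_one] at h
      have hx1 : x ≤ 1 := by nlinarith [mul_self_nonneg y]
      have hx2 : -1 ≤ x := by nlinarith [mul_self_nonneg y]
      have hy1 : y ≤ 1 := by nlinarith [mul_self_nonneg x]
      have hy2 : -1 ≤ y := by nlinarith [mul_self_nonneg x]
      simp only [Finset.mem_insert, Finset.mem_singleton, Zsqrtd.mk.injEq]
      interval_cases x <;> interval_cases y <;> simp_all
    simpa using (Finset.card_le_card hsub).trans Finset.card_le_four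
  | prime_pow_mul a p k hp hpa hk ih =>
    have ha : a ≠ 0 := by rintro rfl; simp at hn
    obtain ⟨c, hc⟩ := GaussianInt.exists_factor_of_norm_eq_prime_pow_mul hp hpa k
    choose! j hj w hzw hw using fun z (hz : z ∈ S) => hc z (hS z hz)
    have hfib : ∀ i ∈ Finset.range (k + 1),
        (S.filter fun z => j z = i).card ≤ 4 * a.divisors.card := by
      intro i _
      rw [← Finset.card_image_of_injOn (f := w) (s := S.filter fun z => j z = i)]
      · refine ih ha _ fun v hv => ?_
        obtain ⟨z, hz, rfl⟩ := Finset.mem_image.1 hv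
        exact hw z (Finset.mem_filter.1 hz).1
      · intro x hx y hy hxy
        simp only [Finset.coe_filter, Set.mem_ofPred_eq] at hx hy
        rw [hzw x hx.1, hzw y hy.1, hx.2, hy.2, hxy]
    have hcop : (p ^ k).Coprime a := Nat.Coprime.pow_left _ ((Nat.Prime.coprime_iff_not_dvd hp).2 hpa)
    have := Finset.card_le_mul_card_image_of_maps_to (s := S) (f := j) hj _ hfib
    rw [Nat.Coprime.card_divisors_mul hcop, Nat.divisors_prime_pow hp, Finset.card_map]
    rw [Finset.card_range] at *
    linarith

/-- The divisor bound `d(n) ≪_ε n ^ ε`. -/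
lemma Nat.exists_card_divisors_le_mul_rpow {ε : ℝ} (hε : 0 < ε) :
    ∃ C : ℝ, 0 < C ∧ ∀ n : ℕ, n ≠ 0 → (n.divisors.card : ℝ) ≤ C * (n : ℝ) ^ ε := by
  set δ := ε * Real.log 2
  have hδ : 0 < δ := mul_pos hε (Real.log_pos (by norm_num))
  set C : ℝ := 1 / δ + 1
  have hC : 1 ≤ C := by simp only [C]; linarith [one_div_pos.2 hδ]
  set P : ℕ := ⌈(2 : ℝ) ^ (1 / ε)⌉₊
  have hlocal : ∀ p e : ℕ, p.Prime →
      ((e : ℝ) + 1) ≤ (if p < P then C else 1) * ((p : ℝ) ^ e) ^ ε := by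
    intro p e hp
    have hp0 : (0 : ℝ) ≤ p := by positivity
    have hp2 : (2 : ℝ) ≤ p := by exact_mod_cast hp.two_le
    have hcomm : ((p : ℝ) ^ e) ^ ε = ((p : ℝ) ^ ε) ^ e := by
      rw [← Real.rpow_natCast, ← Real.rpow_mul hp0, mul_comm, Real.rpow_mul hp0, Real.rpow_natCast]
    split_ifs with h
    · have h1 : 1 + (e : ℝ) * δ ≤ ((p : ℝ) ^ ε) ^ e := by
        have h2 : 1 + δ ≤ (p : ℝ) ^ ε := by
          calc 1 + δ ≤ Real.exp δ := by linarith [Real.add_one_le_exp δ]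
            _ = (2 : ℝ) ^ ε := by rw [Real.rpow_def_of_pos (by norm_num), mul_comm]
            _ ≤ (p : ℝ) ^ ε := Real.rpow_le_rpow (by norm_num) hp2 hε.le
        calc 1 + (e : ℝ) * δ ≤ (1 + δ) ^ e := one_add_mul_le_pow (by linarith) e
          _ ≤ _ := by gcongr
      calc (e : ℝ) + 1 ≤ C * (1 + e * δ) := by
            have : C * (1 + e * δ) = 1 / δ + e + 1 + e * δ := by
              simp only [C]; field_simp; ring
            have h3 : (0 : ℝ) ≤ e * δ := by positivity
            linarith [one_div_pos.2 hδ]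
        _ ≤ _ := by rw [hcomm]; gcongr
    · have h2 : (2 : ℝ) ≤ (p : ℝ) ^ ε := by
        have h3 : (2 : ℝ) ^ (1 / ε) ≤ p := (Nat.le_ceil _).trans (by exact_mod_cast not_lt.1 h)
        calc (2 : ℝ) = ((2 : ℝ) ^ (1 / ε)) ^ ε := by
              rw [← Real.rpow_mul (by norm_num), one_div_mul_cancel hε.ne', Real.rpow_one]
          _ ≤ _ := Real.rpow_le_rpow (by positivity) h3 hε.le
      rw [one_mul, hcomm]
      calc (e : ℝ) + 1 ≤ 2 ^ e := by exact_mod_cast Nat.lt_two_pow_self (n := e)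
        _ ≤ _ := by gcongr
  refine ⟨C ^ P, by positivity, fun n hn => ?_⟩
  have hprod : (n : ℝ) ^ ε = ∏ p ∈ n.primeFactors, ((p : ℝ) ^ n.factorization p) ^ ε := by
    rw [Real.finsetProd_rpow _ _ (fun _ _ => by positivity)]
    congr 1
    exact_mod_cast (Nat.prod_factorization_pow_eq_self hn).symm
  rw [Nat.card_divisors hn, hprod]
  push_cast
  calc ∏ p ∈ n.primeFactors, ((n.factorization p : ℝ) + 1)
      ≤ ∏ p ∈ n.primeFactors,
          (if p < P then C else 1) * ((p : ℝ) ^ n.factorization p) ^ ε :=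
        Finset.prod_le_prod (fun _ _ => by positivity)
          (fun p hp => hlocal p _ (Nat.prime_of_mem_primeFactors hp))
    _ = C ^ (n.primeFactors.filter (· < P)).card *
          ∏ p ∈ n.primeFactors, ((p : ℝ) ^ n.factorization p) ^ ε := by
        rw [Finset.prod_mul_distrib, Finset.prod_ite]; simp
    _ ≤ _ := by
        gcongr
        calc (n.primeFactors.filter (· < P)).card ≤ (Finset.range P).card :=
            Finset.card_le_card fun p hp => by simpa using (Finset.mem_filter.1 hp).2
          _ = P := Finset.card_range P

/-- A circle centred at the origin which contains three distinct lattice points at mutual distances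
`O(N)` has radius `O(N ^ 3)`. -/
lemma GaussianInt.norm_le_of_three_points {x y z : GaussianInt} (hxy : x ≠ y) (hxz : x ≠ z)
    (hyz : y ≠ z) (hy : y.norm = x.norm) (hz : z.norm = x.norm) {N : ℝ}
    (h1 : |((y.re - x.re : ℤ) : ℝ)| ≤ N) (h2 : |((y.im - x.im : ℤ) : ℝ)| ≤ N)
    (h3 : |((z.re - x.re : ℤ) : ℝ)| ≤ N) (h4 : |((z.im - x.im : ℤ) : ℝ)| ≤ N) :
    (x.norm : ℝ) ≤ 8 * N ^ 6 := by
  obtain ⟨a, b⟩ := x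
  obtain ⟨a', b'⟩ := y
  obtain ⟨a'', b''⟩ := z
  obtain ⟨s, rfl⟩ : ∃ s, a' = a + s := ⟨a' - a, by ring⟩
  obtain ⟨t, rfl⟩ : ∃ t, b' = b + t := ⟨b' - b, by ring⟩
  obtain ⟨u, rfl⟩ : ∃ u, a'' = a + u := ⟨a'' - a, by ring⟩
  obtain ⟨v, rfl⟩ : ∃ v, b'' = b + v := ⟨b'' - b, by ring⟩
  simp only [Zsqrtd.norm_def, add_sub_cancel_left, ne_eq, Zsqrtd.mk.injEq] at *
  have e1 : 2 * (a * s + b * t) = -(s ^ 2 + t ^ 2) := by linarith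
  have e2 : 2 * (a * u + b * v) = -(u ^ 2 + v ^ 2) := by linarith
  have ea : 2 * a * (s * v - t * u) = -(s ^ 2 + t ^ 2) * v + (u ^ 2 + v ^ 2) * t := by
    linear_combination v * e1 - t * e2
  have eb : 2 * b * (s * v - t * u) = (s ^ 2 + t ^ 2) * u - (u ^ 2 + v ^ 2) * s := by
    linear_combination s * e2 - u * e1
  have hdet : s * v - t * u ≠ 0 := by
    intro h0
    rw [h0, mul_zero] at ea eb
    have hp : 0 < s ^ 2 + t ^ 2 := by
      rcases eq_or_ne s 0 with rfl | hs
      · have : t ≠ 0 := by rintro rfl; simp at hxy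
        positivity
      · positivity
    have hq : 0 < u ^ 2 + v ^ 2 := by
      rcases eq_or_ne u 0 with rfl | hs
      · have : v ≠ 0 := by rintro rfl; simp at hxz
        positivity
      · positivity
    have hpq : s ^ 2 + t ^ 2 = u ^ 2 + v ^ 2 := by
      refine mul_left_cancel₀ (mul_pos hp hq).ne' ?_
      linear_combination ((s ^ 2 + t ^ 2) * v + (u ^ 2 + v ^ 2) * t) * ea -
        ((s ^ 2 + t ^ 2) * u + (u ^ 2 + v ^ 2) * s) * eb
    rw [← hpq] at ea eb
    have hvt : v = t := mul_left_cancel₀ hp.ne' (by linarith)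
    have hus : u = s := mul_left_cancel₀ hp.ne' (by linarith)
    exact hyz ⟨by rw [hus], by rw [hvt]⟩
  have hd : (1 : ℝ) ≤ |((s * v - t * u : ℤ) : ℝ)| := by
    exact_mod_cast Int.one_le_abs hdet
  have bound : ∀ c f g : ℝ, 2 * c * ((s * v - t * u : ℤ) : ℝ) =
      ((s : ℝ) ^ 2 + t ^ 2) * f + ((u : ℝ) ^ 2 + v ^ 2) * g → |f| ≤ N → |g| ≤ N →
      c ^ 2 ≤ 4 * N ^ 6 := by
    intro c f g h hf hg
    have hs := sq_le_sq' (abs_le.1 h1).1 (abs_le.1 h1).2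
    have ht := sq_le_sq' (abs_le.1 h2).1 (abs_le.1 h2).2
    have hu := sq_le_sq' (abs_le.1 h3).1 (abs_le.1 h3).2
    have hv := sq_le_sq' (abs_le.1 h4).1 (abs_le.1 h4).2
    have hc : |c| ≤ 2 * N ^ 3 := by
      have : 2 * |c| ≤ 4 * N ^ 3 := by
        calc 2 * |c| ≤ 2 * |c| * |((s * v - t * u : ℤ) : ℝ)| :=
              le_mul_of_one_le_right (by positivity) hd
          _ = |2 * c * ((s * v - t * u : ℤ) : ℝ)| := by rw [abs_mul, abs_mul, abs_two]
          _ ≤ |((s : ℝ) ^ 2 + t ^ 2) * f| + |((u : ℝ) ^ 2 + v ^ 2) * g| := by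
              rw [h]; exact abs_add_le _ _
          _ = ((s : ℝ) ^ 2 + t ^ 2) * |f| + ((u : ℝ) ^ 2 + v ^ 2) * |g| := by
              rw [abs_mul, abs_mul, abs_of_nonneg (by positivity : (0 : ℝ) ≤ (s : ℝ) ^ 2 + t ^ 2),
                abs_of_nonneg (by positivity : (0 : ℝ) ≤ (u : ℝ) ^ 2 + v ^ 2)]
          _ ≤ (N ^ 2 + N ^ 2) * N + (N ^ 2 + N ^ 2) * N := by gcongr
          _ = 4 * N ^ 3 := by ring
      linarith
    calc c ^ 2 = |c| ^ 2 := (sq_abs c).symm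
      _ ≤ (2 * N ^ 3) ^ 2 := by gcongr
      _ = 4 * N ^ 6 := by ring
  have ha := bound a (-v) t (by have := congrArg (Int.cast (R := ℝ)) ea; push_cast at this ⊢; linarith)
    (by rwa [abs_neg]) h2
  have hb := bound b u (-s) (by have := congrArg (Int.cast (R := ℝ)) eb; push_cast at this ⊢; linarith)
    h3 (by rwa [abs_neg])
  push_cast
  nlinarith

/-- Lattice points on a circle centred at the origin inside a square of side `N`. -/
lemma GaussianInt.exists_card_circle_inter_square_le {ε : ℝ} (hε : 0 < ε) :
    ∃ C : ℝ, 0 < C ∧ ∀ N : ℝ, 1 ≤ N → ∀ (B : ℝ) (S : Finset GaussianInt),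
      (∀ z ∈ S, (z.norm : ℝ) = B) →
      (∀ z ∈ S, ∀ w ∈ S, |((z.re - w.re : ℤ) : ℝ)| ≤ N ∧ |((z.im - w.im : ℤ) : ℝ)| ≤ N) →
      (S.card : ℝ) ≤ C * N ^ ε := by
  obtain ⟨C, hC, hdiv⟩ := Nat.exists_card_divisors_le_mul_rpow (div_pos hε (by norm_num : (0 : ℝ) < 6))
  refine ⟨2 + 4 * C * 8 ^ (ε / 6), by positivity, fun N hN B S hS hdist => ?_⟩
  have hN0 : 0 ≤ N := by linarith
  have hNε : 1 ≤ N ^ ε := Real.one_le_rpow hN hε.le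
  have hpos : 0 ≤ 4 * C * 8 ^ (ε / 6) * N ^ ε := by positivity
  rw [add_mul]
  by_cases hcard : S.card ≤ 2
  · have : (S.card : ℝ) ≤ 2 := by exact_mod_cast hcard
    linarith
  obtain ⟨x, hx, y, hy, z, hz, hxy, hxz, hyz⟩ := Finset.two_lt_card.1 (not_le.1 hcard)
  have hnorm : ∀ w ∈ S, w.norm = x.norm := fun w hw => by
    exact_mod_cast (hS w hw).trans (hS x hx).symm
  have hle := GaussianInt.norm_le_of_three_points hxy hxz hyz (hnorm y hy) (hnorm z hz)
    (hdist y hy x hx).1 (hdist y hy x hx).2 (hdist z hz x hx).1 (hdist z hz x hx).2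
  obtain ⟨n, hn⟩ := Int.eq_ofNat_of_zero_le (GaussianInt.norm_nonneg x)
  have hn0 : n ≠ 0 := by
    rintro rfl
    have hx0 := GaussianInt.norm_eq_zero.1 hn
    have hy0 := GaussianInt.norm_eq_zero.1 ((hnorm y hy).trans hn)
    exact hxy (hx0.trans hy0.symm)
  have h1 : (S.card : ℝ) ≤ 4 * n.divisors.card := by
    exact_mod_cast GaussianInt.card_norm_eq_le hn0 S fun w hw => (hnorm w hw).trans hn
  have h2 : (n : ℝ) ^ (ε / 6) ≤ 8 ^ (ε / 6) * N ^ ε := by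
    have hn8 : (n : ℝ) ≤ 8 * N ^ 6 := by
      rw [hn] at hle; exact_mod_cast hle
    calc (n : ℝ) ^ (ε / 6) ≤ (8 * N ^ 6) ^ (ε / 6) :=
          Real.rpow_le_rpow (by positivity) hn8 (by positivity)
      _ = 8 ^ (ε / 6) * N ^ ε := by
          rw [Real.mul_rpow (by norm_num) (by positivity), ← Real.rpow_natCast N 6,
            ← Real.rpow_mul hN0]
          congr 2
          push_cast; ring
  have h3 : C * (n : ℝ) ^ (ε / 6) ≤ C * (8 ^ (ε / 6) * N ^ ε) := by gcongr
  linarith [hdiv n hn0]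

lemma Int.card_Icc_ceil_floor_add_le (b : ℝ) {N : ℝ} (hN : 0 ≤ N) :
    ((Finset.Icc ⌈b⌉ ⌊b + N⌋).card : ℝ) ≤ N + 1 := by
  rw [Int.card_Icc]
  rcases le_total (⌊b + N⌋ + 1 - ⌈b⌉) 0 with h | h
  · rw [Int.toNat_of_nonpos h]; push_cast; linarith
  · have : (((⌊b + N⌋ + 1 - ⌈b⌉).toNat : ℤ) : ℝ) = ((⌊b + N⌋ + 1 - ⌈b⌉ : ℤ) : ℝ) := by
      rw [Int.toNat_of_nonneg h]
    rw [Int.cast_natCast] at this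
    rw [this]
    push_cast
    linarith [Int.floor_le (b + N), Int.le_ceil b]

theorem lattice_points_on_sphere_in_box
    (r : ℕ) (hr : 2 ≤ r) (ε : ℝ) (hε : 0 < ε) :
    ∃ C : ℝ, 0 < C ∧ ∀ (b : Fin r → ℝ) (N : ℝ), 1 ≤ N → ∀ A : ℝ,
      (((latticeBox r b N).filter fun ξ => eNormSq ξ = A).card : ℝ)
        ≤ C * N ^ ((r : ℝ) - 2 + ε) := by
  obtain ⟨k, rfl⟩ : ∃ k, r = k + 2 := ⟨r - 2, by omega⟩
  obtain ⟨C, hC, hcirc⟩ := GaussianInt.exists_card_circle_inter_square_le hε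
  refine ⟨C * 2 ^ k, by positivity, fun b N hN A => ?_⟩
  have hN0 : 0 < N := by linarith
  set S := (latticeBox (k + 2) b N).filter fun ξ => eNormSq ξ = A with hSdef
  have hS : ∀ ξ ∈ S, (∀ i, b i ≤ ξ i ∧ (ξ i : ℝ) ≤ b i + N) ∧ eNormSq ξ = A := by
    intro ξ hξ
    simpa [hSdef, latticeBox, Fintype.mem_piFinset, Int.ceil_le, Int.le_floor] using hξ
  set T := Fintype.piFinset fun i : Fin k => Finset.Icc ⌈b i.succ.succ⌉ ⌊b i.succ.succ + N⌋
  let f : (Fin (k + 2) → ℤ) → Fin k → ℤ := fun ξ i => ξ i.succ.succ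
  let g : (Fin (k + 2) → ℤ) → GaussianInt := fun ξ => ⟨ξ 0, ξ 1⟩
  have hmaps : ∀ ξ ∈ S, f ξ ∈ T := fun ξ hξ => by
    simpa [T, f, Fintype.mem_piFinset, Int.ceil_le, Int.le_floor] using
      fun i : Fin k => (hS ξ hξ).1 i.succ.succ
  have hfib : ∀ η ∈ T, (S.filter fun ξ => f ξ = η).card ≤ ⌊C * N ^ ε⌋₊ := by
    intro η _
    refine Nat.le_floor ?_
    rw [← Finset.card_image_of_injOn (f := g) (s := S.filter fun ξ => f ξ = η)]
    · refine hcirc N hN (A - ∑ i, (η i : ℝ) ^ 2) _ ?_ ?_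
      · intro z hz
        obtain ⟨ξ, hξ, rfl⟩ := Finset.mem_image.1 hz
        obtain ⟨hmem, rfl⟩ := Finset.mem_filter.1 hξ
        rw [← (hS ξ hmem).2, eNormSq, Fin.sum_univ_succ, Fin.sum_univ_succ]
        simp [Zsqrtd.norm_def, f, g]
        ring
      · intro z hz w hw
        obtain ⟨ξ, hξ, rfl⟩ := Finset.mem_image.1 hz
        obtain ⟨ζ, hζ, rfl⟩ := Finset.mem_image.1 hw
        have hξ' := (hS ξ (Finset.mem_filter.1 hξ).1).1
        have hζ' := (hS ζ (Finset.mem_filter.1 hζ).1).1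
        simp only [g, Int.cast_sub, abs_le]
        refine ⟨⟨?_, ?_⟩, ?_, ?_⟩ <;>
          linarith [(hξ' 0).1, (hξ' 0).2, (hζ' 0).1, (hζ' 0).2, (hξ' 1).1, (hξ' 1).2, (hζ' 1).1,
            (hζ' 1).2]
    · intro ξ hξ ζ hζ h
      simp only [Finset.coe_filter, Set.mem_ofPred_eq] at hξ hζ
      simp only [g, Zsqrtd.mk.injEq] at h
      have hf : f ξ = f ζ := hξ.2.trans hζ.2.symm
      funext i
      refine Fin.cases h.1 (fun i => ?_) i
      exact Fin.cases h.2 (fun i => congrFun hf i) i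
  have hT : (T.card : ℝ) ≤ (2 * N) ^ k := by
    rw [Fintype.card_piFinset]
    push_cast
    calc _ ≤ ∏ _i : Fin k, (2 * N) :=
          Finset.prod_le_prod (fun _ _ => by positivity)
            (fun i _ => (Int.card_Icc_ceil_floor_add_le _ hN0.le).trans (by linarith))
      _ = _ := by simp
  calc (S.card : ℝ) ≤ (⌊C * N ^ ε⌋₊ : ℝ) * T.card := by
        exact_mod_cast Finset.card_le_mul_card_image_of_maps_to hmaps _ hfib
    _ ≤ C * N ^ ε * (2 * N) ^ k := by
        gcongr
        exact Nat.floor_le (by positivity)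
    _ = C * 2 ^ k * N ^ (((k + 2 : ℕ) : ℝ) - 2 + ε) := by
        rw [show ((k + 2 : ℕ) : ℝ) - 2 + ε = k + ε by push_cast; ring, Real.rpow_add hN0,
          Real.rpow_natCast, mul_pow]
        ring
end
end

section
/- Let r ≥ 1 be an integer. There exists a constant C = C(r) > 0 such that for all N_1 ≥ N_2 ≥ 1, all b ∈ ℝ^r for which the cube center ξ⁰ is nonzero, and all m ∈ ℤ, the slab K_m contains at most C · M · N_2^{r−1} lattice points, where M = max{N_2²/N_1, 1}. Consequently, for any complex coefficients (a_ξ) and any integers r_0 ≥ 1, r_1 ≥ 0 with r_0 + r_1 = r, one has sup_{(t, x_1) ∈ ℝ × ℝ^{r_1}} |∑_{ξ ∈ K_m} a_ξ e^{−i t |ξ|² + i⟨x_1, ξ_1⟩}| ≤ C^{1/2} · M^{1/2} · N_2^{(r−1)/2} · (∑_{ξ ∈ K_m} |a_ξ|²)^{1/2}. -/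
open MeasureTheory Real
open scoped Classical

noncomputable section

/-- The center `ξ⁰ = b + (N₂/2, …, N₂/2)` of the cube of side `N₂` based at `b`. -/
def cubeCenter (r : ℕ) (b : Fin r → ℝ) (N₂ : ℝ) : Fin r → ℝ := fun i => b i + N₂ / 2

/-- The slab width `M = max(N₂²/N₁, 1)`. -/
def slabWidth (N₁ N₂ : ℝ) : ℝ := max (N₂ ^ 2 / N₁) 1

/-- The slab `K_m = {ξ ∈ J : (m-1)M ≤ ⟨ξ, ξ⁰⟩/|ξ⁰| < mM}` of the cube `J` of side `N₂`. -/
def slab (r : ℕ) (b : Fin r → ℝ) (N₁ N₂ : ℝ) (m : ℤ) : Finset (Fin r → ℤ) :=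
  (latticeBox r b N₂).filter fun ξ =>
    ((m : ℝ) - 1) * slabWidth N₁ N₂ ≤
        (∑ i, (ξ i : ℝ) * cubeCenter r b N₂ i) / Real.sqrt (∑ i, (cubeCenter r b N₂ i) ^ 2) ∧
    (∑ i, (ξ i : ℝ) * cubeCenter r b N₂ i) / Real.sqrt (∑ i, (cubeCenter r b N₂ i) ^ 2) <
        (m : ℝ) * slabWidth N₁ N₂

/-- A finite set of integers of diameter at most `D` has at most `D + 1` elements. -/
theorem Int.card_le_of_forall_sub_le (T : Finset ℤ) (D : ℝ) (hD : 0 ≤ D)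
    (h : ∀ x ∈ T, ∀ y ∈ T, ((x : ℝ) - y) ≤ D) : (T.card : ℝ) ≤ D + 1 := by
  rcases T.eq_empty_or_nonempty with rfl | hT
  · simp only [Finset.card_empty, Nat.cast_zero]
    linarith
  · have hsub : T ⊆ Finset.Icc (T.min' hT) (T.max' hT) := fun x hx =>
      Finset.mem_Icc.2 ⟨T.min'_le x hx, T.le_max' x hx⟩
    have hcard := Finset.card_le_card hsub
    have hmm : T.min' hT ≤ T.max' hT := T.min'_le _ (T.max'_mem hT)
    have hd := h _ (T.max'_mem hT) _ (T.min'_mem hT)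
    rw [Int.card_Icc] at hcard
    have hz : (T.card : ℤ) ≤ T.max' hT + 1 - T.min' hT := by omega
    have hr : (T.card : ℝ) ≤ T.max' hT + 1 - T.min' hT := by exact_mod_cast hz
    linarith

/-- A box of side `N ≥ 1` contains at most `(2 N) ^ n` lattice points. -/
theorem card_latticeBox_le (n : ℕ) (b : Fin n → ℝ) (N : ℝ) (hN : 1 ≤ N) :
    ((latticeBox n b N).card : ℝ) ≤ (2 * N) ^ n := by
  have hfac : ∀ i, ((Finset.Icc ⌈b i⌉ ⌊b i + N⌋).card : ℝ) ≤ 2 * N := fun i => by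
    refine (Int.card_le_of_forall_sub_le _ N (by linarith) fun x hx y hy => ?_).trans (by linarith)
    rw [Finset.mem_Icc, Int.ceil_le, Int.le_floor] at hx hy
    linarith [hx.2, hy.1]
  rw [latticeBox, Fintype.card_piFinset, Nat.cast_prod]
  refine (Finset.prod_le_prod (fun i _ => Nat.cast_nonneg _) fun i _ => hfac i).trans ?_
  simp

/-- Some coordinate of a nonzero vector is nonzero and controls its Euclidean norm. -/
theorem exists_sqrt_sum_sq_le {n : ℕ} (c : Fin n → ℝ) (hc : c ≠ 0) :
    ∃ i, c i ≠ 0 ∧ √(∑ j, c j ^ 2) ≤ n * |c i| := by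
  obtain ⟨k, hk⟩ := Function.ne_iff.1 hc
  obtain ⟨i, -, hi⟩ := Finset.exists_max_image Finset.univ (fun j => |c j|) ⟨k, Finset.mem_univ k⟩
  have hpos : 0 < |c i| := (abs_pos.2 hk).trans_le (hi k (Finset.mem_univ k))
  refine ⟨i, abs_pos.1 hpos, ?_⟩
  have hn : (1 : ℝ) ≤ n := by
    have := k.pos
    exact_mod_cast this
  refine Real.sqrt_le_iff.2 ⟨by positivity, ?_⟩
  calc ∑ j, c j ^ 2 ≤ ∑ _j : Fin n, |c i| ^ 2 :=
        Finset.sum_le_sum fun j hj => by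
          rw [← sq_abs (c j)]
          exact pow_le_pow_left₀ (abs_nonneg _) (hi j hj) 2
    _ = n * |c i| ^ 2 := by simp
    _ ≤ (n * |c i|) ^ 2 := by
        rw [mul_pow]
        exact mul_le_mul_of_nonneg_right (by nlinarith) (by positivity)

/-- Two points of a slab which differ only in the coordinate `i` are close to each other. -/
theorem sub_le_of_mem_slab {r : ℕ} {b : Fin r → ℝ} {N₁ N₂ : ℝ} {m : ℤ} {i : Fin r}
    (hi : cubeCenter r b N₂ i ≠ 0)
    (hs : √(∑ j, cubeCenter r b N₂ j ^ 2) ≤ r * |cubeCenter r b N₂ i|)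
    {ξ η : Fin r → ℤ} (hξ : ξ ∈ slab r b N₁ N₂ m) (hη : η ∈ slab r b N₁ N₂ m)
    (h : ∀ j, j ≠ i → ξ j = η j) : ((ξ i : ℝ) - η i) ≤ r * slabWidth N₁ N₂ := by
  obtain ⟨-, hξ₁, hξ₂⟩ := Finset.mem_filter.1 hξ
  obtain ⟨-, hη₁, hη₂⟩ := Finset.mem_filter.1 hη
  set c := cubeCenter r b N₂ with hc
  set s := √(∑ j, c j ^ 2) with hs_def
  have hM : 0 ≤ slabWidth N₁ N₂ := zero_le_one.trans (le_max_right _ _)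
  have hci : 0 < |c i| := abs_pos.2 hi
  have hspos : 0 < s := Real.sqrt_pos.2 <|
    (by positivity : 0 < c i ^ 2).trans_le
      (Finset.single_le_sum (f := fun j => c j ^ 2) (fun j _ => sq_nonneg _) (Finset.mem_univ i))
  have hdiff : ∑ j, (ξ j : ℝ) * c j - ∑ j, (η j : ℝ) * c j = ((ξ i : ℝ) - η i) * c i := by
    rw [← Finset.sum_sub_distrib, Finset.sum_eq_single i]
    · ring
    · intro j _ hj
      rw [h j hj, sub_self]
    · simp
  have hdiv : (∑ j, (ξ j : ℝ) * c j) / s - (∑ j, (η j : ℝ) * c j) / s =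
      ((ξ i : ℝ) - η i) * c i / s := by
    rw [← sub_div, hdiff]
  have habs : |((ξ i : ℝ) - η i) * c i / s| ≤ slabWidth N₁ N₂ := by
    rw [← hdiv, abs_le]
    constructor <;> linarith
  rw [abs_div, abs_mul, abs_of_pos hspos, div_le_iff₀ hspos] at habs
  refine (le_abs_self _).trans (le_of_mul_le_mul_right ?_ hci)
  calc _ ≤ slabWidth N₁ N₂ * s := habs
    _ ≤ slabWidth N₁ N₂ * (r * |c i|) := mul_le_mul_of_nonneg_left hs hM
    _ = _ := by ring

/-- The slab contains at most `O(M N₂ ^ n)` lattice points in dimension `n + 1`. -/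
theorem card_slab_le (n : ℕ) (b : Fin (n + 1) → ℝ) (N₁ N₂ : ℝ) (hN₂ : 1 ≤ N₂)
    (hc : cubeCenter (n + 1) b N₂ ≠ 0) (m : ℤ) :
    ((slab (n + 1) b N₁ N₂ m).card : ℝ) ≤
      ((n + 2 : ℝ) * 2 ^ n) * slabWidth N₁ N₂ * N₂ ^ n := by
  obtain ⟨i, hi, hs⟩ := exists_sqrt_sum_sq_le _ hc
  have hM : 1 ≤ slabWidth N₁ N₂ := le_max_right _ _
  have hmaps : ∀ ξ ∈ slab (n + 1) b N₁ N₂ m,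
      i.removeNth ξ ∈ latticeBox n (i.removeNth b) N₂ := fun ξ hξ =>
    Fintype.mem_piFinset.2 fun j => Fintype.mem_piFinset.1 (Finset.mem_filter.1 hξ).1 _
  have hfib : ∀ ζ ∈ latticeBox n (i.removeNth b) N₂,
      ((slab (n + 1) b N₁ N₂ m).filter fun ξ => i.removeNth ξ = ζ).card ≤
        ⌊(n + 2 : ℝ) * slabWidth N₁ N₂⌋₊ := by
    intro ζ _
    have hagree : ∀ ξ η : Fin (n + 1) → ℤ, i.removeNth ξ = ζ → i.removeNth η = ζ →
        ∀ j, j ≠ i → ξ j = η j := by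
      intro ξ η hξ hη j hj
      obtain ⟨k, rfl⟩ := Fin.exists_succAbove_eq hj
      exact congrFun (hξ.trans hη.symm) k
    refine Nat.le_floor ?_
    rw [← Finset.card_image_of_injOn (f := fun ξ : Fin (n + 1) → ℤ => ξ i)]
    · refine (Int.card_le_of_forall_sub_le _ ((n + 1 : ℕ) * slabWidth N₁ N₂)
        (by positivity) ?_).trans ?_
      · intro x hx y hy
        obtain ⟨ξ, hξ, rfl⟩ := Finset.mem_image.1 hx
        obtain ⟨η, hη, rfl⟩ := Finset.mem_image.1 hy
        rw [Finset.mem_filter] at hξ hη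
        exact sub_le_of_mem_slab hi hs hξ.1 hη.1 (hagree ξ η hξ.2 hη.2)
      · push_cast
        linarith
    · intro ξ hξ η hη hξη
      rw [Finset.mem_coe, Finset.mem_filter] at hξ hη
      funext j
      by_cases hj : j = i
      · rw [hj]
        exact hξη
      · exact hagree ξ η hξ.2 hη.2 j hj
  have hcard := Finset.card_le_mul_card_image_of_maps_to hmaps _ hfib
  calc ((slab (n + 1) b N₁ N₂ m).card : ℝ)
      ≤ (⌊(n + 2 : ℝ) * slabWidth N₁ N₂⌋₊ : ℝ) * (latticeBox n (i.removeNth b) N₂).card := by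
        exact_mod_cast hcard
    _ ≤ ((n + 2 : ℝ) * slabWidth N₁ N₂) * (2 * N₂) ^ n :=
        mul_le_mul (Nat.floor_le (by positivity)) (card_latticeBox_le n _ N₂ hN₂)
          (Nat.cast_nonneg _) (by positivity)
    _ = _ := by ring

/-- Cauchy–Schwarz for exponential sums with real phases. -/
theorem norm_sum_mul_exp_le {ι : Type*} (S : Finset ι) (a : ι → ℂ) (φ : ι → ℝ) :
    ‖∑ ξ ∈ S, a ξ * Complex.exp (Complex.I * (φ ξ : ℂ))‖ ≤
      (S.card : ℝ) ^ ((1 : ℝ) / 2) * (∑ ξ ∈ S, ‖a ξ‖ ^ 2) ^ ((1 : ℝ) / 2) := by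
  have hnorm : ‖∑ ξ ∈ S, a ξ * Complex.exp (Complex.I * (φ ξ : ℂ))‖ ≤ ∑ ξ ∈ S, ‖a ξ‖ := by
    refine (norm_sum_le _ _).trans_eq (Finset.sum_congr rfl fun ξ _ => ?_)
    rw [norm_mul, mul_comm Complex.I, Complex.norm_exp_ofReal_mul_I, mul_one]
  rw [← Real.sqrt_eq_rpow, ← Real.sqrt_eq_rpow, ← Real.sqrt_mul (Nat.cast_nonneg _)]
  exact hnorm.trans (Real.le_sqrt_of_sq_le sq_sum_le_card_mul_sum_sq)

theorem slab_cardinality_and_sup_bound (r : ℕ) (hr : 1 ≤ r) :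
    ∃ C : ℝ, 0 < C ∧ ∀ (N₁ N₂ : ℝ), 1 ≤ N₂ → N₂ ≤ N₁ →
      ∀ (b : Fin r → ℝ), cubeCenter r b N₂ ≠ 0 → ∀ (m : ℤ),
      ((slab r b N₁ N₂ m).card : ℝ) ≤ C * slabWidth N₁ N₂ * N₂ ^ ((r : ℝ) - 1) ∧
      ∀ a : (Fin r → ℤ) → ℂ, ∀ (r₀ r₁ : ℕ), 1 ≤ r₀ → ∀ (h : r₀ + r₁ = r),
        ∀ (t : ℝ) (x₁ : Fin r₁ → ℝ),
          ‖∑ ξ ∈ slab r b N₁ N₂ m,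
              a ξ * Complex.exp (Complex.I *
                (((-(t * eNormSq ξ) +
                    ∑ i : Fin r₁, x₁ i * (ξ ⟨r₀ + (i : ℕ), by omega⟩ : ℝ)) : ℝ) : ℂ))‖
            ≤ C ^ ((1 : ℝ) / 2) * (slabWidth N₁ N₂) ^ ((1 : ℝ) / 2) *
                N₂ ^ (((r : ℝ) - 1) / 2) *
              (∑ ξ ∈ slab r b N₁ N₂ m, ‖a ξ‖ ^ 2) ^ ((1 : ℝ) / 2) := by
  obtain ⟨n, rfl⟩ := Nat.exists_eq_add_of_le' hr
  refine ⟨(n + 2 : ℝ) * 2 ^ n, by positivity, fun N₁ N₂ hN₂ _ b hc m => ?_⟩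
  have hM : 0 ≤ slabWidth N₁ N₂ := zero_le_one.trans (le_max_right _ _)
  have hN : 0 ≤ N₂ := zero_le_one.trans hN₂
  have hexp : ((n + 1 : ℕ) : ℝ) - 1 = n := by
    push_cast
    ring
  have hcard := card_slab_le n b N₁ N₂ hN₂ hc m
  rw [← Real.rpow_natCast N₂ n] at hcard
  rw [hexp]
  refine ⟨hcard, fun a r₀ r₁ _ h t x₁ => (norm_sum_mul_exp_le _ _ _).trans ?_⟩
  refine mul_le_mul_of_nonneg_right ?_ (by positivity)
  refine (Real.rpow_le_rpow (Nat.cast_nonneg _) hcard (by norm_num)).trans_eq ?_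
  rw [Real.mul_rpow (by positivity) (by positivity), Real.mul_rpow (by positivity) hM,
    ← Real.rpow_mul hN, mul_one_div]
end
end

section
/- Let r ≥ 1 be an integer, p ∈ [1, ∞), b ∈ ℝ^r, and let a : ℤ^r → ℂ be finitely supported. Then ∫_{[0,2π]} ∫_{[0,2π]^r} | ∑_{ν ∈ ℤ^r} a_ν e^{−i t |ν + b|² + i⟨x, ν + b⟩} |^p dx dt = ∫_{[0,2π]} ∫_{[0,2π]^r} | ∑_{ν ∈ ℤ^r} a_ν e^{−i t |ν|² + i⟨x, ν⟩} |^p dx dt. In other words, the L^p_{t,x}([0,2π]^{1+r}) norm of the exponential sum is invariant under translating the frequency set by b (Galilean invariance on the torus). -/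
open MeasureTheory Real

noncomputable section

open scoped Pointwise

/-- The integral of a function on `ι → ℝ` which is `T`-periodic in each coordinate over the cube
`[0, T]^ι` is invariant under translations. -/
theorem setIntegral_cube_add_left_of_periodic {ι E : Type*} [Fintype ι] [DecidableEq ι]
    [NormedAddCommGroup E] [NormedSpace ℝ E] {T : ℝ} (hT : 0 < T) {f : (ι → ℝ) → E}
    (hf : ∀ i x, f (Pi.single i T + x) = f x) (c : ι → ℝ) :
    ∫ x in (Set.univ.pi fun _ : ι => Set.Icc (0 : ℝ) T), f (c + x) =
      ∫ x in (Set.univ.pi fun _ : ι => Set.Icc (0 : ℝ) T), f x := by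
  have hcube : (Set.univ.pi fun _ : ι => Set.Ico (0 : ℝ) T) =ᵐ[volume]
      Set.univ.pi fun _ : ι => Set.Icc (0 : ℝ) T := Measure.pi_Ico_ae_eq_pi_Icc
  rw [← setIntegral_congr_set hcube, ← setIntegral_congr_set hcube]
  let B : Module.Basis ι ℝ (ι → ℝ) :=
    (Pi.basisFun ℝ ι).isUnitSMul (w := fun _ => T) fun _ => hT.ne'.isUnit
  have hB (i : ι) : B i = Pi.single i T := by
    simp [B, Module.Basis.isUnitSMul_apply, ← Pi.single_smul]
  have hdom : ZSpan.fundamentalDomain B = Set.univ.pi fun _ : ι => Set.Ico (0 : ℝ) T := by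
    ext x
    simp only [ZSpan.mem_fundamentalDomain, B, Module.Basis.repr_isUnitSMul, Pi.basisFun_repr,
      Units.smul_def, Units.val_inv_eq_inv_val, IsUnit.unit_spec, smul_eq_mul, Set.mem_pi,
      Set.mem_univ, true_imp_iff, Set.mem_Ico, inv_mul_lt_one₀ hT]
    simp only [inv_pos.2 hT, mul_nonneg_iff_of_pos_left]
  have hinv (g : Submodule.span ℤ (Set.range B)) (x : ι → ℝ) : f (g +ᵥ x) = f x := by
    obtain ⟨g, hg⟩ := g
    change f (g + x) = f x
    induction hg using Submodule.span_induction generalizing x with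
    | mem y hy => obtain ⟨i, rfl⟩ := hy; rw [hB, hf]
    | zero => rw [zero_add]
    | add y z _ _ hy hz => rw [add_assoc, hy, hz]
    | smul n y _ hy =>
      have hper : Function.Periodic f y := fun x => by rw [add_comm, hy]
      rw [add_comm]
      exact hper.zsmul n x
  have hD := ZSpan.isAddFundamentalDomain B volume
  rw [hdom] at hD
  have : VAddInvariantMeasure (Submodule.span ℤ (Set.range B)) (ι → ℝ) volume :=
    inferInstanceAs
      (VAddInvariantMeasure (Submodule.span ℤ (Set.range B)).toAddSubgroup (ι → ℝ) volume)
  calc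
    _ = ∫ x in c +ᵥ (Set.univ.pi fun _ : ι => Set.Ico (0 : ℝ) T), f x :=
      ((measurePreserving_add_left volume c).setIntegral_image_emb
        (measurableEmbedding_addLeft c) f _).symm
    _ = _ := (hD.vadd_of_comm c).setIntegral_eq hD hinv

/-- Adding `2π` to a coordinate of `x` does not change a plane wave with integer frequency. -/
theorem exp_I_mul_add_single_two_pi {ι : Type*} [Fintype ι] [DecidableEq ι] (s : ℝ) (ν : ι → ℤ)
    (i : ι) (x : ι → ℝ) :
    Complex.exp (Complex.I *
        ((s + ∑ j, (Pi.single i (2 * π) + x : ι → ℝ) j * (ν j : ℝ) : ℝ) : ℂ)) =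
      Complex.exp (Complex.I * ((s + ∑ j, x j * (ν j : ℝ) : ℝ) : ℂ)) := by
  have hsum : ∑ j, (Pi.single i (2 * π) + x : ι → ℝ) j * (ν j : ℝ) =
      2 * π * ν i + ∑ j, x j * (ν j : ℝ) := by
    simp [add_mul, Finset.sum_add_distrib, Pi.single_apply]
  rw [hsum, Complex.exp_eq_exp_iff_exists_int]
  exact ⟨ν i, by push_cast; ring⟩

/-- Translating the frequencies by `b` changes the exponential sum by a unimodular factor and a
translation of `x` by `-2tb`. -/
theorem norm_sum_exp_add_frequency {ι : Type*} [Fintype ι] (b : ι → ℝ) (S : Finset (ι → ℤ))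
    (a : (ι → ℤ) → ℂ) (t : ℝ) (x : ι → ℝ) :
    ‖∑ ν ∈ S, a ν * Complex.exp (Complex.I *
        ((-(t * ∑ i, ((ν i : ℝ) + b i) ^ 2) + ∑ i, x i * ((ν i : ℝ) + b i) : ℝ) : ℂ))‖ =
      ‖∑ ν ∈ S, a ν * Complex.exp (Complex.I *
        ((-(t * ∑ i, (ν i : ℝ) ^ 2) + ∑ i, ((-(2 * t)) • b + x) i * (ν i : ℝ) : ℝ) : ℂ))‖ := by
  have hphase (ν : ι → ℤ) :
      -(t * ∑ i, ((ν i : ℝ) + b i) ^ 2) + ∑ i, x i * ((ν i : ℝ) + b i) =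
        (-(t * ∑ i, b i ^ 2) + ∑ i, x i * b i) +
          (-(t * ∑ i, (ν i : ℝ) ^ 2) + ∑ i, ((-(2 * t)) • b + x) i * (ν i : ℝ)) := by
    simp only [Finset.mul_sum, ← Finset.sum_neg_distrib, ← Finset.sum_add_distrib]
    refine Finset.sum_congr rfl fun i _ => ?_
    simp only [Pi.add_apply, Pi.smul_apply, smul_eq_mul]
    ring
  simp only [hphase]
  simp only [Complex.ofReal_add (-(t * ∑ i, b i ^ 2) + ∑ i, x i * b i), mul_add Complex.I,
    Complex.exp_add, mul_left_comm (a _)]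
  rw [← Finset.mul_sum, norm_mul, Complex.norm_exp_I_mul_ofReal, one_mul]

theorem galilean_invariance
    (r : ℕ) (hr : 1 ≤ r) (p : ℝ) (hp : 1 ≤ p) (b : Fin r → ℝ)
    (a : (Fin r → ℤ) →₀ ℂ) :
    (∫ t in (0:ℝ)..(2 * π),
      ∫ x in (Set.univ.pi fun _ : Fin r => Set.Icc (0:ℝ) (2 * π)),
        ‖∑ ν ∈ a.support,
            a ν * Complex.exp (Complex.I *
              (((-(t * ∑ i, ((ν i : ℝ) + b i) ^ 2) +
                  ∑ i, x i * ((ν i : ℝ) + b i)) : ℝ) : ℂ))‖ ^ p)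
    =
    (∫ t in (0:ℝ)..(2 * π),
      ∫ x in (Set.univ.pi fun _ : Fin r => Set.Icc (0:ℝ) (2 * π)),
        ‖∑ ν ∈ a.support,
            a ν * Complex.exp (Complex.I *
              (((-(t * ∑ i, ((ν i : ℝ)) ^ 2) +
                  ∑ i, x i * (ν i : ℝ)) : ℝ) : ℂ))‖ ^ p) := by
  refine intervalIntegral.integral_congr fun t _ => ?_
  simp only [norm_sum_exp_add_frequency b]
  exact setIntegral_cube_add_left_of_periodic (f := fun x => ‖∑ ν ∈ a.support,
    a ν * Complex.exp (Complex.I *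
      ((-(t * ∑ i, (ν i : ℝ) ^ 2) + ∑ i, x i * (ν i : ℝ) : ℝ) : ℂ))‖ ^ p) two_pi_pos
    (fun i x => by simp only [exp_I_mul_add_single_two_pi]) ((-(2 * t)) • b)
end
end

section
/- Fix κ ≥ 1. There exists a constant C = C(κ) > 0 such that for every integer N ≥ 2, every κ-admissible weight w : ℤ → [0,1], every b ∈ ℤ, every pair of coprime integers a, q with 1 ≤ a ≤ q < N, and every t ∈ ℝ with |t − a/q| < 1/(qN), one has | ∑_{n ∈ ℤ} w(n − b) e^{2πi t n²} | ≤ C · q^{−1/2} · (|t − a/q| + N^{−2})^{−1/2}, with the bound uniform in b. -/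
open MeasureTheory Real

noncomputable section

/-- A `κ`-admissible weight at scale `N`: values in `[0,1]`, equal to `1` on `[0,N]`,
vanishing outside `[-N, 2N]`, with first differences bounded by `κ N⁻¹` and total variation
of the first differences bounded by `κ N⁻¹`. -/
def KAdmissibleWeight (κ : ℝ) (N : ℕ) (w : ℤ → ℝ) : Prop :=
  (∀ n : ℤ, w n ∈ Set.Icc (0 : ℝ) 1) ∧
  (∀ n : ℤ, 0 ≤ n → n ≤ (N : ℤ) → w n = 1) ∧
  (∀ n : ℤ, (n < -(N : ℤ) ∨ 2 * (N : ℤ) < n) → w n = 0) ∧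
  (∀ n : ℤ, |w (n + 1) - w n| ≤ κ / (N : ℝ)) ∧
  (∑' n : ℤ, |w (n + 2) - 2 * w (n + 1) + w n|) ≤ κ / (N : ℝ)

/-- The weighted Weyl sum `∑ₙ w(n - b) e^{2πitn²}` (a finite sum, since `w` vanishes
outside `[-N, 2N]`). -/
def weightedWeylSum (N : ℕ) (w : ℤ → ℝ) (b : ℤ) (t : ℝ) : ℂ :=
  ∑ n ∈ Finset.Icc (b - (N : ℤ)) (b + 2 * (N : ℤ)),
    (w (n - b) : ℂ) * Complex.exp (Complex.I * ((2 * π * t * (n : ℝ) ^ 2 : ℝ) : ℂ))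

/-- Summing by parts twice: an exponential sum with weight `v` is controlled by the total
variation of the first differences of `v`. -/
lemma norm_sum_mul_zpow_mul_norm_sub_one_sq_le {v : ℤ → ℝ} {I : Finset ℤ}
    (hv : ∀ n ∉ I, v n = 0) {z : ℂ} (hz : ‖z‖ = 1) :
    ‖∑ n ∈ I, (v n : ℂ) * z ^ n‖ * ‖z - 1‖ ^ 2 ≤
      ∑' n : ℤ, |v (n + 2) - 2 * v (n + 1) + v n| := by
  have hz0 : z ≠ 0 := by
    rintro rfl
    simp at hz
  set G := ∑ n ∈ I, (v n : ℂ) * z ^ n with hG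
  have h0 : HasSum (fun n : ℤ => (v n : ℂ) * z ^ n) G :=
    hasSum_sum_of_ne_finset_zero fun n hn => by simp [hv n hn]
  have h1 := (Equiv.addRight (1 : ℤ)).hasSum_iff.mpr h0
  have h2 := (Equiv.addRight (2 : ℤ)).hasSum_iff.mpr h0
  have h := (h2.sub (h1.mul_left (2 * z))).add (h0.mul_left (z ^ 2))
  have hterm : ∀ n : ℤ,
      ‖((fun n : ℤ => (v n : ℂ) * z ^ n) ∘ (Equiv.addRight (2 : ℤ))) n
        - 2 * z * ((fun n : ℤ => (v n : ℂ) * z ^ n) ∘ (Equiv.addRight (1 : ℤ))) n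
        + z ^ 2 * ((v n : ℂ) * z ^ n)‖ = |v (n + 2) - 2 * v (n + 1) + v n| := by
    intro n
    have : ((fun n : ℤ => (v n : ℂ) * z ^ n) ∘ (Equiv.addRight (2 : ℤ))) n
        - 2 * z * ((fun n : ℤ => (v n : ℂ) * z ^ n) ∘ (Equiv.addRight (1 : ℤ))) n
        + z ^ 2 * ((v n : ℂ) * z ^ n)
        = ((v (n + 2) - 2 * v (n + 1) + v n : ℝ) : ℂ) * z ^ (n + 2) := by
      have e2 : z ^ (n + 2) = z ^ n * z ^ 2 := by
        rw [zpow_add₀ hz0]; norm_cast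
      simp only [Function.comp_apply, Equiv.coe_addRight, zpow_add_one₀ hz0, e2]
      push_cast
      ring
    rw [this, norm_mul, norm_zpow, hz, one_zpow, mul_one, Complex.norm_real, Real.norm_eq_abs]
  have hsum : ∀ k : ℤ, Summable fun n => v (n + k) := fun k =>
    (Equiv.addRight k).summable_iff.mpr
      (summable_of_ne_finset_zero (s := I) fun n hn => hv n hn)
  have hs : Summable fun n : ℤ => |v (n + 2) - 2 * v (n + 1) + v n| := by
    have := (((hsum 2).sub ((hsum 1).mul_left 2)).add (hsum 0)).abs
    simpa using this
  have hn := norm_tsum_le_tsum_norm (hs.congr fun n => (hterm n).symm)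
  rw [h.tsum_eq, tsum_congr hterm] at hn
  refine le_trans (le_of_eq ?_) hn
  rw [← norm_pow, ← norm_mul]
  congr 1
  ring

/-- The second differences of `n ↦ u (n + h) * u n`, through the discrete Leibniz rule. -/
lemma tsum_abs_second_diff_mul_shift_le {u : ℤ → ℝ} {I : Finset ℤ} {δ : ℝ}
    (hu : ∀ n, u n ∈ Set.Icc (0 : ℝ) 1) (hI : ∀ n ∉ I, u n = 0)
    (h1 : ∀ n, |u (n + 1) - u n| ≤ δ)
    (h2 : ∑' n : ℤ, |u (n + 2) - 2 * u (n + 1) + u n| ≤ δ) (h : ℤ) :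
    ∑' n : ℤ, |u (n + 2 + h) * u (n + 2) - 2 * (u (n + 1 + h) * u (n + 1)) + u (n + h) * u n|
      ≤ 2 * δ + 4 * δ ^ 2 * (I.card : ℝ) := by
  have hδ : 0 ≤ δ := (abs_nonneg _).trans (h1 0)
  have hsum : ∀ k : ℤ, Summable fun n => u (n + k) := fun k =>
    (Equiv.addRight k).summable_iff.mpr
      (summable_of_ne_finset_zero (s := I) fun n hn => hI n hn)
  have hs : Summable fun n : ℤ => |u (n + 2) - 2 * u (n + 1) + u n| := by
    have := (((hsum 2).sub ((hsum 1).mul_left 2)).add (hsum 0)).abs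
    simpa using this
  have hA := hs.hasSum
  have hB := (Equiv.addRight h).hasSum_iff.mpr hA
  set χ : ℤ → ℝ := fun n => if n ∈ I then 1 else 0 with hχ
  have hχs : HasSum χ (I.card : ℝ) := by
    have : HasSum χ (∑ n ∈ I, χ n) := hasSum_sum_of_ne_finset_zero fun n hn => by simp [hχ, hn]
    simpa [hχ] using this
  have hC1 := (Equiv.addRight (1 : ℤ)).hasSum_iff.mpr hχs
  have hC2 := (Equiv.addRight (2 : ℤ)).hasSum_iff.mpr hχs
  have hT := (hB.add hA).add ((hC1.add hC2).mul_left (2 * δ ^ 2))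
  have hdiff : ∀ n, |u (n + 2) - u (n + 1)| ≤ δ * (χ (n + 1) + χ (n + 2)) := by
    intro n
    have := h1 (n + 1)
    rw [add_assoc, show (1 : ℤ) + 1 = 2 from rfl] at this
    by_cases m1 : n + 1 ∈ I <;> by_cases m2 : n + 2 ∈ I
    · simp only [hχ, m1, m2, if_true]; linarith
    · simp only [hχ, m1, m2, if_true, if_false]; linarith
    · simp only [hχ, m1, m2, if_true, if_false]; linarith
    · simp [hχ, m1, m2, hI _ m1, hI _ m2]
  have hle : ∀ n : ℤ,
      |u (n + 2 + h) * u (n + 2) - 2 * (u (n + 1 + h) * u (n + 1)) + u (n + h) * u n| ≤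
      (|u (n + h + 2) - 2 * u (n + h + 1) + u (n + h)| + |u (n + 2) - 2 * u (n + 1) + u n|) +
        2 * δ ^ 2 * (χ (n + 1) + χ (n + 2)) := by
    intro n
    rw [show n + 2 + h = n + h + 2 by ring, show n + 1 + h = n + h + 1 by ring]
    have e : u (n + h + 2) * u (n + 2) - 2 * (u (n + h + 1) * u (n + 1)) + u (n + h) * u n =
        (u (n + h + 2) - 2 * u (n + h + 1) + u (n + h)) * u (n + 2) +
        u (n + h) * (u (n + 2) - 2 * u (n + 1) + u n) +
        2 * ((u (n + h + 1) - u (n + h)) * (u (n + 2) - u (n + 1))) := by ring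
    rw [e]
    refine (abs_add_three _ _ _).trans ?_
    simp only [abs_mul, abs_of_nonneg (hu _).1, abs_two]
    have b1 := mul_le_mul_of_nonneg_left (hu (n + 2)).2
      (abs_nonneg (u (n + h + 2) - 2 * u (n + h + 1) + u (n + h)))
    have b2 := mul_le_mul_of_nonneg_right (hu (n + h)).2
      (abs_nonneg (u (n + 2) - 2 * u (n + 1) + u n))
    have b3 := mul_le_mul (h1 (n + h)) (hdiff n) (abs_nonneg _) hδ
    linarith
  have hs' : Summable fun n : ℤ =>
      |u (n + 2 + h) * u (n + 2) - 2 * (u (n + 1 + h) * u (n + 1)) + u (n + h) * u n| :=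
    Summable.of_nonneg_of_le (fun _ => abs_nonneg _) hle hT.summable
  refine (hasSum_le hle hs'.hasSum hT).trans ?_
  linarith

/-- Weyl differencing. -/
lemma norm_sq_sum_le_sum_norm_autocorrelation {f : ℤ → ℂ} {I H : Finset ℤ}
    (hf : ∀ n ∉ I, f n = 0) (hH : ∀ m ∈ I, ∀ n ∈ I, m - n ∈ H) :
    ‖∑ n ∈ I, f n‖ ^ 2 ≤ ∑ h ∈ H, ‖∑ n ∈ I, f (n + h) * (starRingEnd ℂ) (f n)‖ := by
  have key : (∑ n ∈ I, f n) * (starRingEnd ℂ) (∑ n ∈ I, f n) =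
      ∑ h ∈ H, ∑ n ∈ I, f (n + h) * (starRingEnd ℂ) (f n) := by
    rw [Finset.sum_comm, map_sum, Finset.mul_sum]
    refine Finset.sum_congr rfl fun n hn => ?_
    rw [← Finset.sum_mul]
    congr 1
    rw [show ∑ h ∈ H, f (n + h) = ∑ m ∈ H.map (addLeftEmbedding n), f m from
      (Finset.sum_map H (addLeftEmbedding n) f).symm]
    refine Finset.sum_subset (fun m hm => ?_) fun m _ hm => hf m hm
    exact Finset.mem_map.mpr ⟨m - n, hH m hm n hn, by simp⟩
  calc ‖∑ n ∈ I, f n‖ ^ 2 = ‖(∑ n ∈ I, f n) * (starRingEnd ℂ) (∑ n ∈ I, f n)‖ := by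
        rw [norm_mul, RCLike.norm_conj, sq]
    _ ≤ _ := by rw [key]; exact norm_sum_le _ _

/-- The chord from `1` to `exp (2πix)` is at least four times the distance of `x` to `ℤ`. -/
lemma four_mul_abs_sub_round_le (x : ℝ) :
    4 * |x - round x| ≤ ‖Complex.exp (Complex.I * ((2 * π * x : ℝ) : ℂ)) - 1‖ := by
  have e : Complex.exp (Complex.I * ((2 * π * x : ℝ) : ℂ)) =
      Complex.exp (Complex.I * ((2 * π * (x - round x) : ℝ) : ℂ)) := by
    rw [Complex.exp_eq_exp_iff_exists_int]
    refine ⟨round x, ?_⟩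
    push_cast
    ring
  rw [e, Complex.norm_exp_I_mul_ofReal_sub_one, Real.norm_eq_abs, abs_mul, abs_two,
    show 2 * π * (x - round x) / 2 = π * (x - round x) by ring]
  have hx := abs_sub_round x
  have habs : |π * (x - round x)| = π * |x - round x| := by
    rw [abs_mul, abs_of_pos Real.pi_pos]
  have := Real.mul_abs_le_abs_sin (x := π * (x - round x))
    (by rw [habs]; nlinarith [Real.pi_pos])
  rw [habs] at this
  have e2 : 2 / π * (π * |x - round x|) = 2 * |x - round x| := by
    field_simp
  linarith

/-- A set of integers of diameter at most `L`, pairwise congruent modulo `q` after doubling. -/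
lemma card_le_of_dvd_two_mul_sub {S : Finset ℤ} {q : ℤ} {L : ℝ} (hq : 0 < q) (hL : 0 ≤ L)
    (hS : ∀ x ∈ S, ∀ y ∈ S, q ∣ 2 * (x - y) ∧ |((x - y : ℤ) : ℝ)| ≤ L) :
    (S.card : ℝ) ≤ 2 * L / q + 1 := by
  have hq' : (0 : ℝ) < q := by exact_mod_cast hq
  rcases S.eq_empty_or_nonempty with rfl | hne
  · simp only [Finset.card_empty, Nat.cast_zero]
    positivity
  set m := S.min' hne with hm
  have hmS : m ∈ S := S.min'_mem hne
  have hc : S.card ≤ (Finset.Icc (0 : ℤ) ⌊2 * L / q⌋).card := by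
    refine Finset.card_le_card_of_injOn (fun x => 2 * (x - m) / q) ?_ ?_
    · intro x hx
      have hx : x ∈ S := hx
      obtain ⟨hd, hl⟩ := hS x hx m hmS
      obtain ⟨k, hk⟩ := hd
      have hmx : m ≤ x := S.min'_le x hx
      simp only [Finset.coe_Icc, Set.mem_Icc]
      rw [hk, Int.mul_ediv_cancel_left _ hq.ne']
      constructor
      · by_contra hlt
        nlinarith
      · rw [Int.le_floor, le_div_iff₀ hq']
        have hk' : 2 * ((x - m : ℤ) : ℝ) = q * k := by exact_mod_cast hk
        linarith [le_abs_self ((x - m : ℤ) : ℝ)]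
    · intro x hx y hy hxy
      obtain ⟨k, hk⟩ := (hS x hx m hmS).1
      obtain ⟨l, hl⟩ := (hS y hy m hmS).1
      simp only [hk, hl, Int.mul_ediv_cancel_left _ hq.ne'] at hxy
      rw [← hxy] at hl
      omega
  have h0 : 0 ≤ ⌊2 * L / q⌋ := Int.floor_nonneg.mpr (by positivity)
  calc (S.card : ℝ) ≤ ((Finset.Icc (0 : ℤ) ⌊2 * L / q⌋).card : ℝ) := by exact_mod_cast hc
    _ = (⌊2 * L / q⌋ : ℝ) + 1 := by
        rw [Int.card_Icc]
        have : (((⌊2 * L / q⌋ + 1 - 0).toNat : ℤ) : ℝ) = ((⌊2 * L / q⌋ + 1 - 0 : ℤ) : ℝ) := by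
          rw [Int.toNat_of_nonneg (by omega)]
        push_cast at this ⊢
        simpa using this
    _ ≤ _ := by linarith [Int.floor_le (2 * L / q)]

/-- The number of `|h| ≤ 3 * N` for which `2 * t * h` lies in a given cell of length `1 / N`
modulo one, when `t` is close to `a / q`. -/
lemma card_cell_le {N : ℕ} {a q j : ℤ} {t : ℝ} {S : Finset ℤ} (hq : 0 < q) (hqN : q < N)
    (haq : Int.gcd a q = 1) (ht : |t - (a : ℝ) / q| < 1 / ((q : ℝ) * N))
    (hS : ∀ h ∈ S, |(h : ℝ)| ≤ 3 * N)
    (hj : ∀ h ∈ S, round ((N : ℝ) * (2 * t * h - round (2 * t * h))) = j) :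
    (S.card : ℝ) ≤ 432 / (N * (|t - (a : ℝ) / q| + 1 / (N : ℝ) ^ 2) * q) := by
  have hq' : (0 : ℝ) < q := by exact_mod_cast hq
  have hqN' : (q : ℝ) < N := by exact_mod_cast hqN
  have hN : (0 : ℝ) < N := hq'.trans hqN'
  set β := t - (a : ℝ) / q with hβ
  set D := |β| + 1 / (N : ℝ) ^ 2 with hD
  have hDpos : 0 < D := by positivity
  have ht' : |β| * (q * N) < 1 := by rwa [lt_div_iff₀ (by positivity)] at ht
  rcases S.eq_empty_or_nonempty with rfl | ⟨h₀, hh₀⟩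
  · simp only [Finset.card_empty, Nat.cast_zero]
    positivity
  set m : ℤ → ℤ := fun h => round (2 * t * h) with hm
  set y : ℤ → ℝ := fun h => 2 * t * h - m h with hy
  have hyy : ∀ h ∈ S, ∀ k ∈ S, |y h - y k| ≤ 1 / N := by
    intro h hh k hk
    have e1 := abs_sub_round ((N : ℝ) * y h)
    have e2 := abs_sub_round ((N : ℝ) * y k)
    rw [show round ((N : ℝ) * y h) = j from hj h hh] at e1
    rw [show round ((N : ℝ) * y k) = j from hj k hk] at e2
    rw [le_div_iff₀ hN, show |y h - y k| * (N : ℝ) = |(y h - y k) * N| by rw [abs_mul, abs_of_pos hN]]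
    rw [abs_le] at e1 e2 ⊢
    constructor <;> linarith
  have hhk : ∀ h ∈ S, ∀ k ∈ S, |(h : ℝ) - k| ≤ 6 * N := by
    intro h hh k hk
    have e1 := hS h hh
    have e2 := hS k hk
    rw [abs_le] at e1 e2 ⊢
    constructor <;> linarith
  set s : ℤ → ℤ := fun h => 2 * a * (h - h₀) - q * (m h - m h₀) with hs
  have hsid : ∀ h k : ℤ, ((s h : ℝ) - s k) = q * ((y h - y k) - 2 * β * (h - k)) := by
    intro h k
    simp only [hs, hy, hβ]
    push_cast
    field_simp
    ring
  have hs0 : s h₀ = 0 := by simp [hs]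
  have hsmem : ∀ h ∈ S, s h ∈ Finset.Icc (-13 : ℤ) 13 := by
    intro h hh
    have e := hsid h h₀
    rw [hs0, Int.cast_zero, sub_zero] at e
    have e1 := hyy h hh h₀ hh₀
    have e2 := hhk h hh h₀ hh₀
    have : |(s h : ℝ)| ≤ 13 := by
      rw [e, abs_mul, abs_of_pos hq']
      have e3 : |(y h - y h₀) - 2 * β * (h - h₀)| ≤ 1 / N + 2 * |β| * (6 * N) := by
        refine (abs_sub _ _).trans ?_
        rw [abs_mul, abs_mul, abs_two]
        gcongr
      have e4 : (q : ℝ) * (1 / N) ≤ 1 := by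
        rw [mul_one_div, div_le_one hN]; exact hqN'.le
      calc (q : ℝ) * |(y h - y h₀) - 2 * β * (h - h₀)|
          ≤ q * (1 / N + 2 * |β| * (6 * N)) := by gcongr
        _ = q * (1 / N) + 12 * (|β| * (q * N)) := by ring
        _ ≤ 13 := by linarith
    rw [Finset.mem_Icc, ← abs_le]
    exact_mod_cast this
  have hfib : ∀ r ∈ Finset.Icc (-13 : ℤ) 13,
      (((S.filter fun h => s h = r).card : ℕ) : ℝ) ≤ 2 * (7 / (N * D)) / q + 1 := by
    intro r _
    refine card_le_of_dvd_two_mul_sub hq (by positivity) fun h hh k hk => ?_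
    rw [Finset.mem_filter] at hh hk
    have hsk : s h = s k := hh.2.trans hk.2.symm
    constructor
    · have : q ∣ a * (2 * (h - k)) := by
        refine ⟨m h - m k, ?_⟩
        simp only [hs] at hsk
        linarith
      refine Int.dvd_of_dvd_mul_right_of_gcd_one this ?_
      rw [Int.gcd_comm]
      exact haq
    · have e := hsid h k
      rw [hsk, sub_self] at e
      have e' : 2 * β * (h - k) = y h - y k := by
        have := (mul_eq_zero.mp e.symm).resolve_left hq'.ne'
        linarith
      have e1 := hyy h hh.1 k hk.1
      have e2 := hhk h hh.1 k hk.1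
      rw [← e', abs_mul, abs_mul, abs_two] at e1
      push_cast
      rw [le_div_iff₀ (by positivity)]
      have e3 : |β| * |(h : ℝ) - k| * N ≤ 1 := by
        rw [le_div_iff₀ hN] at e1
        nlinarith [mul_nonneg (mul_nonneg (abs_nonneg β) (abs_nonneg ((h : ℝ) - k))) hN.le]
      calc |(h : ℝ) - k| * (N * D)
          = |β| * |(h : ℝ) - k| * N + |(h : ℝ) - k| / N := by
            rw [hD]; field_simp
        _ ≤ 1 + 6 := by
            gcongr
            rwa [div_le_iff₀ hN]
        _ = 7 := by norm_num
  have hNDq : N * D * q ≤ 2 := by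
    have : N * D * q = |β| * (q * N) + q / N := by
      rw [hD]; field_simp
    rw [this]
    have : (q : ℝ) / N ≤ 1 := by rw [div_le_one hN]; exact hqN'.le
    linarith
  rw [Finset.card_eq_sum_card_fiberwise (f := s) (t := Finset.Icc (-13 : ℤ) 13) hsmem]
  push_cast
  refine (Finset.sum_le_card_nsmul _ _ _ hfib).trans ?_
  have hone : 1 ≤ 2 / (N * D * q) := by
    rw [le_div_iff₀ (by positivity)]; linarith
  have hcard : (Finset.Icc (-13 : ℤ) 13).card = 27 := rfl
  rw [hcard, nsmul_eq_mul]
  calc ((27 : ℕ) : ℝ) * (2 * (7 / (N * D)) / q + 1)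
      ≤ ((27 : ℕ) : ℝ) * (2 * (7 / (N * D)) / q + 2 / (N * D * q)) := by gcongr
    _ = 432 / (N * D * q) := by
        field_simp
        norm_num

lemma summable_one_div_one_add_int_sq : Summable fun j : ℤ => 1 / (1 + (j : ℝ) ^ 2) := by
  refine Summable.of_norm_bounded_eventually
    (Real.summable_one_div_int_pow.mpr (by norm_num : 1 < 2)) ?_
  filter_upwards [(Set.finite_singleton (0 : ℤ)).compl_mem_cofinite] with j hj
  have hj0 : (j : ℝ) ≠ 0 := by exact_mod_cast hj
  have : 0 < (j : ℝ) ^ 2 := by positivity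
  rw [Real.norm_of_nonneg (by positivity)]
  gcongr
  linarith

/-- A single correlation of the weighted quadratic phase, bounded in terms of the cell of length
`1 / N` that contains `2 * t * h` modulo one. -/
lemma norm_weyl_correlation_le {κ : ℝ} (hκ : 1 ≤ κ) {N : ℕ} (hN : 2 ≤ N) {w : ℤ → ℝ}
    (hw : KAdmissibleWeight κ N w) (b : ℤ) (t : ℝ) {f : ℤ → ℂ}
    (hf : f = fun n : ℤ => (w (n - b) : ℂ) *
      Complex.exp (Complex.I * ((2 * π * t * (n : ℝ) ^ 2 : ℝ) : ℂ))) (h : ℤ) :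
    ‖∑ n ∈ Finset.Icc (b - (N : ℤ)) (b + 2 * (N : ℤ)), f (n + h) * (starRingEnd ℂ) (f n)‖ ≤
      12 * κ ^ 2 * N *
        (1 / (1 + (round ((N : ℝ) * (2 * t * h - round (2 * t * h))) : ℝ) ^ 2)) := by
  obtain ⟨hw01, -, hw0, hw1, hw2⟩ := hw
  have hN' : (2 : ℝ) ≤ N := by exact_mod_cast hN
  have hNpos : (0 : ℝ) < N := by linarith
  set I := Finset.Icc (b - (N : ℤ)) (b + 2 * (N : ℤ)) with hI
  have hIcard : (I.card : ℝ) ≤ 4 * N := by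
    have : I.card ≤ 4 * N := by
      rw [hI, Int.card_Icc]
      omega
    exact_mod_cast this
  set u : ℤ → ℝ := fun n => w (n - b) with hu
  have hu0 : ∀ n ∉ I, u n = 0 := by
    intro n hn
    apply hw0
    rw [hI, Finset.mem_Icc] at hn
    omega
  set z := Complex.exp (Complex.I * ((2 * π * (2 * t * h) : ℝ) : ℂ)) with hz
  have hz1 : ‖z‖ = 1 := by rw [hz, mul_comm]; exact Complex.norm_exp_ofReal_mul_I _
  set v : ℤ → ℝ := fun n => u (n + h) * u n with hv
  have hE : ‖∑ n ∈ I, f (n + h) * (starRingEnd ℂ) (f n)‖ = ‖∑ n ∈ I, (v n : ℂ) * z ^ n‖ := by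
    have hterm : ∀ n : ℤ, f (n + h) * (starRingEnd ℂ) (f n) =
        Complex.exp (((2 * π * t * (h : ℝ) ^ 2 : ℝ) : ℂ) * Complex.I) * ((v n : ℂ) * z ^ n) := by
      intro n
      rw [hf, hz, ← Complex.exp_int_mul]
      simp only [map_mul, Complex.conj_ofReal, ← Complex.exp_conj, Complex.conj_I, hv, hu]
      have e : Complex.exp (Complex.I * ((2 * π * t * ((n + h : ℤ) : ℝ) ^ 2 : ℝ) : ℂ)) *
          Complex.exp (-Complex.I * ((2 * π * t * (n : ℝ) ^ 2 : ℝ) : ℂ)) =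
          Complex.exp (((2 * π * t * (h : ℝ) ^ 2 : ℝ) : ℂ) * Complex.I) *
          Complex.exp (n * (Complex.I * ((2 * π * (2 * t * h) : ℝ) : ℂ))) := by
        rw [← Complex.exp_add, ← Complex.exp_add]
        congr 1
        push_cast
        ring
      push_cast at e ⊢
      linear_combination (w (n + h - b) : ℂ) * (w (n - b) : ℂ) * e
    rw [Finset.sum_congr rfl fun n _ => hterm n, ← Finset.mul_sum, norm_mul,
      Complex.norm_exp_ofReal_mul_I, one_mul]
  rw [hE]
  set E := ‖∑ n ∈ I, (v n : ℂ) * z ^ n‖ with hEdef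
  have hEtriv : E ≤ 4 * N := by
    refine (norm_sum_le _ _).trans (le_trans ?_ hIcard)
    have : ∀ n ∈ I, ‖(v n : ℂ) * z ^ n‖ ≤ 1 := by
      intro n _
      rw [norm_mul, norm_zpow, hz1, one_zpow, mul_one, Complex.norm_real, Real.norm_eq_abs,
        abs_of_nonneg (mul_nonneg (hw01 _).1 (hw01 _).1)]
      exact mul_le_one₀ (hw01 _).2 (hw01 _).1 (hw01 _).2
    simpa using Finset.sum_le_card_nsmul _ _ _ this
  have hlin := norm_sum_mul_zpow_mul_norm_sub_one_sq_le (v := v) (I := I)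
    (fun n hn => by simp [hv, hu0 n hn]) hz1
  have hu1 : ∀ n, |u (n + 1) - u n| ≤ κ / N := by
    intro n
    have := hw1 (n - b)
    rwa [show n - b + 1 = n + 1 - b by ring] at this
  have hu2 : ∑' n : ℤ, |u (n + 2) - 2 * u (n + 1) + u n| ≤ κ / N := by
    rw [← (Equiv.subRight b).tsum_eq] at hw2
    refine le_trans (le_of_eq (tsum_congr fun n => ?_)) hw2
    simp only [hu, Equiv.subRight_apply]
    rw [show n - b + 2 = n + 2 - b by ring, show n - b + 1 = n + 1 - b by ring]
  have htv := tsum_abs_second_diff_mul_shift_le (fun n => hw01 (n - b)) hu0 hu1 hu2 h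
  set x := 2 * t * (h : ℝ) with hx
  set y := x - round x with hy
  have hchord : 4 * |y| ≤ ‖z - 1‖ := four_mul_abs_sub_round_le x
  have hEnn : 0 ≤ E := norm_nonneg _
  have hEy : E * (N * y) ^ 2 ≤ 2 * κ ^ 2 * N := by
    have e1 : E * (4 * |y|) ^ 2 ≤ 2 * (κ / N) + 4 * (κ / N) ^ 2 * (4 * N) := by
      refine le_trans (by gcongr) ((hlin.trans htv).trans (by gcongr))
    have e2 : 2 * (κ / N) + 4 * (κ / N) ^ 2 * (4 * N) ≤ 18 * κ ^ 2 / N := by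
      have : 2 * (κ / N) + 4 * (κ / N) ^ 2 * (4 * N) = (2 * κ + 16 * κ ^ 2) / N := by
        field_simp
        norm_num
      rw [this]
      gcongr
      nlinarith
    have e3 := e1.trans e2
    rw [le_div_iff₀ hNpos, mul_pow, sq_abs] at e3
    have e4 := mul_le_mul_of_nonneg_right e3 hNpos.le
    nlinarith [mul_nonneg (sq_nonneg κ) hNpos.le]
  set j := round ((N : ℝ) * y) with hj
  have hjy : (j : ℝ) ^ 2 ≤ 4 * (N * y) ^ 2 := by
    have hr := abs_sub_round ((N : ℝ) * y)
    rw [← hj, abs_le] at hr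
    have : |(j : ℝ)| ≤ 2 * |(N : ℝ) * y| := by
      rcases eq_or_ne j 0 with h0 | h0
      · rw [h0]; simp only [Int.cast_zero, abs_zero]; positivity
      · have h1 : (1 : ℝ) ≤ |(j : ℝ)| := by exact_mod_cast Int.one_le_abs h0
        rcases abs_cases (j : ℝ) with ⟨e, _⟩ | ⟨e, _⟩ <;>
          rcases abs_cases ((N : ℝ) * y) with ⟨e', _⟩ | ⟨e', _⟩ <;> linarith
    calc (j : ℝ) ^ 2 = |(j : ℝ)| ^ 2 := (sq_abs _).symm
      _ ≤ (2 * |(N : ℝ) * y|) ^ 2 := by gcongr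
      _ = 4 * (N * y) ^ 2 := by rw [mul_pow, sq_abs]; norm_num
  rw [mul_one_div, le_div_iff₀ (by positivity)]
  have := mul_le_mul_of_nonneg_left hjy hEnn
  have hκ2 : (N : ℝ) ≤ κ ^ 2 * N := le_mul_of_one_le_left hNpos.le (one_le_pow₀ hκ)
  linarith

theorem weyl_sum_major_arc_bound (κ : ℝ) (hκ : 1 ≤ κ) :
    ∃ C : ℝ, 0 < C ∧ ∀ (N : ℕ), 2 ≤ N → ∀ (w : ℤ → ℝ), KAdmissibleWeight κ N w →
      ∀ (b : ℤ) (a q : ℤ), 1 ≤ a → a ≤ q → q < (N : ℤ) → Int.gcd a q = 1 →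
        ∀ t : ℝ, |t - (a : ℝ) / (q : ℝ)| < 1 / ((q : ℝ) * (N : ℝ)) →
          ‖weightedWeylSum N w b t‖ ≤
            C * (q : ℝ) ^ (-(1 : ℝ) / 2) *
              (|t - (a : ℝ) / (q : ℝ)| + (N : ℝ) ^ (-(2 : ℝ))) ^ (-(1 : ℝ) / 2) := by
  set K : ℝ := ∑' j : ℤ, 1 / (1 + (j : ℝ) ^ 2) with hK
  have hKpos : 0 < K := summable_one_div_one_add_int_sq.tsum_pos (fun j => by positivity) 0
    (by norm_num)
  refine ⟨√(5184 * κ ^ 2 * K), by positivity, ?_⟩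
  intro N hN w hw b a q ha haq hqN hgcd t ht
  have hq : 0 < q := by omega
  have hq' : (0 : ℝ) < q := by exact_mod_cast hq
  have hNpos : (0 : ℝ) < N := by positivity
  have hpow : (N : ℝ) ^ (-(2 : ℝ)) = 1 / (N : ℝ) ^ 2 := by
    rw [Real.rpow_neg hNpos.le, Real.rpow_two, one_div]
  rw [hpow]
  set D := |t - (a : ℝ) / (q : ℝ)| + 1 / (N : ℝ) ^ 2 with hD
  have hDpos : 0 < D := by positivity
  set f : ℤ → ℂ := fun n : ℤ => (w (n - b) : ℂ) *
    Complex.exp (Complex.I * ((2 * π * t * (n : ℝ) ^ 2 : ℝ) : ℂ)) with hf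
  set c : ℤ → ℤ := fun h => round ((N : ℝ) * (2 * t * h - round (2 * t * h))) with hc
  set H := Finset.Icc (-(3 * (N : ℤ))) (3 * N) with hH
  have hsq : ‖weightedWeylSum N w b t‖ ^ 2 ≤ 5184 * κ ^ 2 * K * (1 / (q * D)) := by
    calc ‖weightedWeylSum N w b t‖ ^ 2
        ≤ ∑ h ∈ H, ‖∑ n ∈ Finset.Icc (b - (N : ℤ)) (b + 2 * (N : ℤ)),
            f (n + h) * (starRingEnd ℂ) (f n)‖ := by
          refine norm_sq_sum_le_sum_norm_autocorrelation (f := f) (fun n hn => ?_)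
            fun m hm n hn => ?_
          · rw [Finset.mem_Icc] at hn
            have : w (n - b) = 0 := hw.2.2.1 _ (by omega)
            simp [hf, this]
          · rw [Finset.mem_Icc] at hm hn ⊢
            omega
      _ ≤ ∑ h ∈ H, 12 * κ ^ 2 * N * (1 / (1 + (c h : ℝ) ^ 2)) :=
          Finset.sum_le_sum fun h _ => norm_weyl_correlation_le hκ hN hw b t hf h
      _ = 12 * κ ^ 2 * N * ∑ j ∈ H.image c,
            ((H.filter fun h => c h = j).card : ℝ) * (1 / (1 + (j : ℝ) ^ 2)) := by
          rw [← Finset.mul_sum, Finset.sum_comp (fun j : ℤ => 1 / (1 + (j : ℝ) ^ 2)) c]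
          simp only [nsmul_eq_mul]
      _ ≤ 12 * κ ^ 2 * N * ∑ j ∈ H.image c,
            432 / (N * D * q) * (1 / (1 + (j : ℝ) ^ 2)) := by
          gcongr with j _
          refine card_cell_le (j := j) hq hqN hgcd ht (fun h hh => ?_) fun h hh => ?_
          · have := (Finset.mem_filter.mp hh).1
            rw [hH, Finset.mem_Icc, ← abs_le] at this
            exact_mod_cast this
          · exact (Finset.mem_filter.mp hh).2
      _ ≤ 12 * κ ^ 2 * N * (432 / (N * D * q) * K) := by
          rw [← Finset.mul_sum]
          gcongr
          exact summable_one_div_one_add_int_sq.sum_le_tsum _ fun j _ => by positivity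
      _ = 5184 * κ ^ 2 * K * (1 / (q * D)) := by
          field_simp
          norm_num
  have hhalf : ∀ x : ℝ, 0 < x → x ^ (-(1 : ℝ) / 2) = √(1 / x) := by
    intro x hx
    rw [neg_div, Real.rpow_neg hx.le, ← Real.sqrt_eq_rpow, one_div, Real.sqrt_inv]
  rw [hhalf _ hq', hhalf _ hDpos, mul_assoc, ← Real.sqrt_mul (by positivity),
    ← Real.sqrt_mul (by positivity)]
  refine Real.le_sqrt_of_sq_le (hsq.trans (le_of_eq ?_))
  field_simp
end
end
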